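/- arXiv:2105.00179 — 2 statements merged into one kernel-verified Lean document; each statement's English description precedes it below -/
import Mathlib

section
/- For every integer n ≥ 3 there exist positive integers c_{ij} (for 1 ≤ j ≤ i ≤ n) such that, setting σ = Σ_{i=1}^{n−1} c_{(i+1)i}², the following holds: for every real d ≥ 1, every real ε with 0 < ε < min{1/σ, min_{1≤i≤n} 1/(2c_{ii}), 1/12}, every set D with {0, e₁, …, eₙ} ⊆ D ⊆ B_d(0) ⊆ ℝⁿ, and every function f : D → ℝⁿ with f(0) = 0 satisfying |‖f(x) − f(y)‖ − ‖x − y‖| ≤ ε for all x, y ∈ D, there exists an isometry U : D → ℝⁿ such that ‖f(x) − U(x)‖ ≤ [ Σ_{i=1}^{n} ( (2 + Σ_{j=1}^{i} c_{ij})·d + 4 + Σ_{j=1}^{i} c_{ij} )² ]^{1/2} · ε for all x ∈ D. -/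
/-- Almost orthonormal families are close to orthonormal ones, linearly in the Gram defect. -/
theorem exists_orthonormal_near_of_gram_near {E : Type*} [NormedAddCommGroup E]
    [InnerProductSpace ℝ E] (m : ℕ) :
    ∃ K : ℕ, ∀ η : ℝ, 0 ≤ η → K * η ≤ 1 → ∀ v : Fin m → E,
      (∀ i j, |inner ℝ (v i) (v j) - if i = j then 1 else 0| ≤ η) →
      ∃ w : Fin m → E, Orthonormal ℝ w ∧ ∀ i, ‖w i - v i‖ ≤ K * η := by
  induction m with
  | zero => exact ⟨0, fun η _ _ v _ => ⟨v, ⟨fun i => i.elim0, fun i => i.elim0⟩, fun i => i.elim0⟩⟩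
  | succ m ih =>
    obtain ⟨K, hK⟩ := ih
    refine ⟨K + 2 * (m * (1 + 2 * K)) + 2, fun η hη hsmall v hv => ?_⟩
    push_cast at hsmall ⊢
    have hKη : 0 ≤ (K : ℝ) * η := by positivity
    have hMη : 0 ≤ (m : ℝ) * (1 + 2 * K) * η := by positivity
    obtain ⟨w, hw, hwv⟩ := hK η hη (by nlinarith) (fun i => v i.castSucc) (fun i j => by
      simpa [Fin.ext_iff] using hv i.castSucc j.castSucc)
    set x := v (Fin.last m) with hx
    have hxn : |‖x‖ - 1| ≤ η := by
      have h := hv (Fin.last m) (Fin.last m)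
      simp only [if_true, ← hx, real_inner_self_eq_norm_sq] at h
      refine le_trans ?_ h
      rw [show ‖x‖ ^ 2 - 1 = (‖x‖ - 1) * (‖x‖ + 1) by ring, abs_mul,
        abs_of_nonneg (by positivity : 0 ≤ ‖x‖ + 1)]
      nlinarith [abs_nonneg (‖x‖ - 1), norm_nonneg x]
    have hx2 : ‖x‖ ≤ 2 := by nlinarith [(abs_le.1 hxn).2]
    have hcoef : ∀ i, |inner ℝ (w i) x| ≤ (1 + 2 * K) * η := fun i => by
      have h := hv i.castSucc (Fin.last m)
      rw [if_neg (Fin.castSucc_lt_last i).ne, sub_zero] at h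
      have hsplit : inner ℝ (w i) x =
          inner ℝ (v i.castSucc) x + inner ℝ (w i - v i.castSucc) x := by
        rw [inner_sub_left]; ring
      rw [hsplit]
      have h2 := (abs_real_inner_le_norm (w i - v i.castSucc) x).trans
        (mul_le_mul (hwv i) hx2 (norm_nonneg _) hKη)
      exact (abs_add_le _ _).trans (by linarith)
    set p := ∑ i, inner ℝ (w i) x • w i with hp
    have hpn : ‖p‖ ≤ m * (1 + 2 * K) * η := by
      refine (norm_sum_le _ _).trans ((Finset.sum_le_card_nsmul _ _ ((1 + 2 * K) * η) ?_).trans ?_)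
      · intro i _
        rw [norm_smul, hw.1 i, mul_one]
        exact hcoef i
      · simp [mul_assoc]
    set u := x - p with hu
    have hun : |‖u‖ - 1| ≤ m * (1 + 2 * K) * η + η := by
      have h1 : |‖u‖ - ‖x‖| ≤ ‖p‖ := by
        have := abs_norm_sub_norm_le u x
        rwa [show u - x = -p by rw [hu]; abel, norm_neg] at this
      have := abs_sub_le ‖u‖ ‖x‖ 1
      linarith
    have hupos : 0 < ‖u‖ := by nlinarith [(abs_le.1 hun).1]
    have horth : ∀ i, inner ℝ (w i) u = 0 := fun i => by
      rw [hu, inner_sub_right, hp, hw.inner_right_fintype, sub_self]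
    refine ⟨Fin.snoc w (‖u‖⁻¹ • u), ⟨fun i => ?_, fun i j hij => ?_⟩, fun i => ?_⟩
    · refine Fin.lastCases ?_ (fun i => ?_) i
      · simp [norm_smul, hupos.ne']
      · simpa using hw.1 i
    · revert hij
      refine Fin.lastCases ?_ (fun i => ?_) i <;> refine Fin.lastCases ?_ (fun j => ?_) j
      · simp
      · intro _
        rw [Fin.snoc_last, Fin.snoc_castSucc, real_inner_smul_left, real_inner_comm, horth, mul_zero]
      · simp [real_inner_smul_right, horth]
      · intro hij
        simpa using hw.2 (fun h => hij (by rw [h]))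
    · refine Fin.lastCases ?_ (fun i => ?_) i
      · rw [Fin.snoc_last, ← hx]
        have h1 : ‖‖u‖⁻¹ • u - u‖ = |‖u‖ - 1| := by
          rw [show ‖u‖⁻¹ • u - u = (‖u‖⁻¹ - 1) • u by rw [sub_smul, one_smul], norm_smul,
            Real.norm_eq_abs, ← abs_of_pos hupos, ← abs_mul, abs_of_pos hupos, sub_mul,
            inv_mul_cancel₀ hupos.ne', one_mul, abs_sub_comm]
        have h2 : ‖u - x‖ = ‖p‖ := by rw [show u - x = -p by rw [hu]; abel, norm_neg]
        have := norm_sub_le_norm_sub_add_norm_sub (‖u‖⁻¹ • u) u x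
        nlinarith
      · rw [Fin.snoc_castSucc]
        refine (hwv i).trans ?_
        nlinarith

theorem abs_sq_sub_sq_le_of_abs_sub_le {a b ε : ℝ} (ha : 0 ≤ a) (hb : 0 ≤ b)
    (h : |a - b| ≤ ε) : |a ^ 2 - b ^ 2| ≤ ε * (2 * b + ε) := by
  rw [show a ^ 2 - b ^ 2 = (a - b) * (a + b) by ring, abs_mul, abs_of_nonneg (add_nonneg ha hb)]
  have := (abs_le.1 h).2
  exact mul_le_mul h (by linarith) (by positivity) ((abs_nonneg _).trans h)

/-- A map that almost preserves the norms of `x`, `y` and `x - y` almost preserves `⟪x, y⟫`. -/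
theorem abs_inner_sub_inner_le_of_abs_norm_sub_norm_le {E F : Type*} [NormedAddCommGroup E]
    [InnerProductSpace ℝ E] [NormedAddCommGroup F] [InnerProductSpace ℝ F] {x y : E} {x' y' : F}
    {ε d : ℝ} (hε : ε ≤ 1) (hd : 1 ≤ d) (hxd : ‖x‖ ≤ d) (hy1 : ‖y‖ = 1)
    (hx : |‖x'‖ - ‖x‖| ≤ ε) (hy : |‖y'‖ - ‖y‖| ≤ ε) (hxy : |‖x' - y'‖ - ‖x - y‖| ≤ ε) :
    |inner ℝ x' y' - inner ℝ x y| ≤ 6 * d * ε := by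
  have hε0 : 0 ≤ ε := (abs_nonneg _).trans hx
  have h1 := abs_sq_sub_sq_le_of_abs_sub_le (norm_nonneg _) (norm_nonneg _) hx
  have h2 := abs_sq_sub_sq_le_of_abs_sub_le (norm_nonneg _) (norm_nonneg _) hy
  have h3 := abs_sq_sub_sq_le_of_abs_sub_le (norm_nonneg _) (norm_nonneg _) hxy
  have h4 : ‖x - y‖ ≤ d + 1 := (norm_sub_le _ _).trans (by linarith)
  have e1 : ε * (2 * ‖x‖ + ε) ≤ ε * (2 * d + 1) := by gcongr
  have e2 : ε * (2 * ‖y‖ + ε) ≤ ε * 3 := by rw [hy1]; gcongr; linarith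
  have e3 : ε * (2 * ‖x - y‖ + ε) ≤ ε * (2 * (d + 1) + 1) := by gcongr
  have e4 : ε * 1 ≤ ε * d := by gcongr
  have i1 := norm_sub_sq_real x y
  have i2 := norm_sub_sq_real x' y'
  rw [abs_le] at h1 h2 h3 ⊢
  constructor <;> linarith


/-- Main theorem (Hyers-Ulam stability of isometries on bounded domains):
for every `n ≥ 3` there exist positive integers `c i j` (for `j ≤ i`) such
that for every `d ≥ 1`, every sufficiently small `ε > 0`, every set `D` with
`{0, e₁, …, eₙ} ⊆ D ⊆ B_d(0)` and every `ε`-isometry `f : D → ℝⁿ` with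
`f 0 = 0`, there is an isometry `U : D → ℝⁿ` with
`‖f x - U x‖ ≤ √(Σᵢ ((2 + Σⱼ cᵢⱼ) d + 4 + Σⱼ cᵢⱼ)²) ε` on `D`. -/
theorem stability_on_bounded_domains (n : ℕ) (hn : 3 ≤ n) :
    ∃ c : Fin n → Fin n → ℕ,
      (∀ i j : Fin n, j ≤ i → 0 < c i j) ∧
      ∀ d : ℝ, 1 ≤ d →
      ∀ ε : ℝ, 0 < ε →
        ε < 1 / (∑ j : Fin (n - 1),
          ((c ⟨(j : ℕ) + 1, by have := j.isLt; omega⟩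
              ⟨(j : ℕ), by have := j.isLt; omega⟩ : ℕ) : ℝ) ^ 2) →
        (∀ i : Fin n, ε < 1 / (2 * (c i i : ℝ))) →
        ε < 1 / 12 →
        ∀ D : Set (EuclideanSpace ℝ (Fin n)),
          (0 : EuclideanSpace ℝ (Fin n)) ∈ D →
          (∀ i : Fin n, EuclideanSpace.single i (1 : ℝ) ∈ D) →
          D ⊆ Metric.closedBall 0 d →
          ∀ f : EuclideanSpace ℝ (Fin n) → EuclideanSpace ℝ (Fin n),
            f 0 = 0 →
            (∀ x ∈ D, ∀ y ∈ D, |‖f x - f y‖ - ‖x - y‖| ≤ ε) →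
            ∃ U : EuclideanSpace ℝ (Fin n) → EuclideanSpace ℝ (Fin n),
              (∀ x ∈ D, ∀ y ∈ D, ‖U x - U y‖ = ‖x - y‖) ∧
              ∀ x ∈ D, ‖f x - U x‖ ≤
                Real.sqrt (∑ i : Fin n,
                  ((2 + ∑ j ∈ Finset.Iic i, (c i j : ℝ)) * d + 4 +
                    ∑ j ∈ Finset.Iic i, (c i j : ℝ)) ^ 2) * ε := by
  obtain ⟨K, hK⟩ := exists_orthonormal_near_of_gram_near (E := EuclideanSpace ℝ (Fin n)) n
  refine ⟨fun _ _ => 6 * K + 4, fun _ _ _ => by positivity, ?_⟩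
  intro d hd ε hε _ hεdiag hε12 D h0 hsingle hD f hf0 hf
  have hnorm : ∀ x ∈ D, |‖f x‖ - ‖x‖| ≤ ε := fun x hx => by
    simpa [hf0] using hf x hx 0 h0
  have hgram : ∀ (r : ℝ), 1 ≤ r → ∀ x ∈ D, ‖x‖ ≤ r → ∀ i,
      |inner ℝ (f x) (f (EuclideanSpace.single i 1)) - x i| ≤ 6 * r * ε := fun r hr x hx hxr i => by
    have h := abs_inner_sub_inner_le_of_abs_norm_sub_norm_le (by linarith) hr hxr
      (by simp : ‖EuclideanSpace.single i (1 : ℝ)‖ = 1) (hnorm x hx) (hnorm _ (hsingle i))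
      (hf x hx _ (hsingle i))
    simpa [EuclideanSpace.inner_single_right] using h
  have hKε : (K : ℝ) * (6 * ε) ≤ 1 := by
    have h := hεdiag ⟨0, by omega⟩
    rw [lt_div_iff₀ (by positivity)] at h
    push_cast at h
    nlinarith
  obtain ⟨w, hw, hwv⟩ := hK (6 * ε) (by positivity) hKε
    (fun i => f (EuclideanSpace.single i 1)) (fun i j => by
      have h := hgram 1 le_rfl _ (hsingle i) (by simp) j
      simpa [Pi.single_apply, eq_comm] using h)
  have : Nonempty (Fin n) := ⟨⟨0, by omega⟩⟩
  obtain ⟨b, hb⟩ : ∃ b : OrthonormalBasis (Fin n) ℝ (EuclideanSpace ℝ (Fin n)), ∀ i, b i = w i :=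
    ⟨(basisOfOrthonormalOfCardEqFinrank hw (by simp)).toOrthonormalBasis (by simpa using hw),
      fun i => by simp⟩
  refine ⟨b.repr.symm, fun x _ y _ => by rw [← map_sub, LinearIsometryEquiv.norm_map], ?_⟩
  intro x hx
  have hxd : ‖x‖ ≤ d := by simpa using hD hx
  have hcoord : ∀ i, |b.repr (f x) i - x i| ≤
      ((2 + ∑ j ∈ Finset.Iic i, ((6 * K + 4 : ℕ) : ℝ)) * d + 4 +
        ∑ j ∈ Finset.Iic i, ((6 * K + 4 : ℕ) : ℝ)) * ε := fun i => by
    have hsum : (6 * K + 4 : ℝ) ≤ ∑ j ∈ Finset.Iic i, ((6 * K + 4 : ℕ) : ℝ) := by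
      have h := Finset.single_le_sum (f := fun _ : Fin n => ((6 * K + 4 : ℕ) : ℝ))
        (fun _ _ => by positivity) (Finset.mem_Iic.2 (le_refl i))
      exact_mod_cast h
    generalize ∑ j ∈ Finset.Iic i, ((6 * K + 4 : ℕ) : ℝ) = S at hsum
    have hfx : ‖f x‖ ≤ d + 1 := by linarith [(abs_le.1 (hnorm x hx)).2]
    have h1 := hgram d hd x hx hxd i
    have h2 := (abs_real_inner_le_norm (f x) (w i - f (EuclideanSpace.single i 1))).trans
      (mul_le_mul hfx (hwv i) (norm_nonneg _) (by linarith))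
    have hsplit : b.repr (f x) i - x i =
        (inner ℝ (f x) (f (EuclideanSpace.single i 1)) - x i) +
          inner ℝ (f x) (w i - f (EuclideanSpace.single i 1)) := by
      rw [b.repr_apply_apply, hb, inner_sub_right, real_inner_comm]; ring
    rw [hsplit]
    refine (abs_add_le _ _).trans ((add_le_add h1 h2).trans ?_)
    calc 6 * d * ε + (d + 1) * (K * (6 * ε)) = (6 * d + (d + 1) * (6 * K)) * ε := by ring
      _ ≤ _ := by
        refine mul_le_mul_of_nonneg_right ?_ hε.le
        nlinarith [mul_le_mul_of_nonneg_right hsum (by linarith : 0 ≤ d)]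
  have hdist : ‖f x - b.repr.symm x‖ = ‖b.repr (f x) - x‖ := by
    rw [← b.repr.norm_map, map_sub, b.repr.apply_symm_apply]
  rw [hdist, EuclideanSpace.norm_eq, ← Real.sqrt_sq hε.le, ← Real.sqrt_mul (Finset.sum_nonneg fun _ _ => sq_nonneg _),
    Finset.sum_mul]
  refine Real.sqrt_le_sqrt (Finset.sum_le_sum fun i _ => ?_)
  rw [← mul_pow]
  exact pow_le_pow_left₀ (norm_nonneg _) (hcoord i) 2
end

section
/- (Väisälä) Let D be a compact subset of ℝⁿ. Suppose there exist points u₀, u₁, …, uₙ ∈ D and a constant K ≥ 1 such that, setting A_{k−1} equal to the affine subspace of ℝⁿ spanned by {u₀, u₁, …, u_{k−1}} and h_k = dist(u_k, A_{k−1}), the sequence is maximal in D, i.e. dist(x, A_{k−1}) ≤ h_k for every x ∈ D and every k ∈ {1, …, n}, and moreover (i) ‖u_k − u₀‖ ≤ K·h_k for every k ∈ {2, 3, …, n}, and (ii) D ∖ {u₁, …, uₙ} is contained in the closed ball of radius K·hₙ centered at u₀. Then there exists a constant K* > 0 such that for every ε > 0 and every function f : D → ℝⁿ satisfying |‖f(x)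 − f(y)‖ − ‖x − y‖| ≤ ε for all x, y ∈ D, there exists an isometry U : ℝⁿ → ℝⁿ with ‖f(x) − U(x)‖ ≤ K*·ε for all x ∈ D. -/
section EuclideanGeometry

variable {E : Type*} [NormedAddCommGroup E] [InnerProductSpace ℝ E]

/-- In a finite-dimensional subspace spanned by finitely many vectors, a vector is controlled by its
inner products with the spanning vectors. -/
theorem exists_norm_le_mul_of_abs_inner_le (v : ℕ → E) (k : ℕ) :
    ∃ C ≥ (0 : ℝ), ∀ y ∈ Submodule.span ℝ (v '' Set.Iio k), ∀ δ : ℝ, 0 ≤ δ →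
      (∀ i < k, |inner ℝ (v i) y| ≤ δ) → ‖y‖ ≤ C * δ := by
  have hfin : FiniteDimensional ℝ (Submodule.span ℝ (v '' Set.Iio k)) :=
    FiniteDimensional.span_of_finite ℝ ((Set.finite_Iio k).image v)
  let Φ : Submodule.span ℝ (v '' Set.Iio k) →ₗ[ℝ] (Fin k → ℝ) :=
    LinearMap.pi fun i => (innerₛₗ ℝ (v i)) ∘ₗ (Submodule.span ℝ (v '' Set.Iio k)).subtype
  have hΦ : ∀ y i, Φ y i = inner ℝ (v i) (y : E) := fun y i => rfl
  have hker : LinearMap.ker Φ = ⊥ := by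
    rw [LinearMap.ker_eq_bot']
    intro y hy
    have hle : Submodule.span ℝ (v '' Set.Iio k) ≤ (ℝ ∙ (y : E))ᗮ := by
      rw [Submodule.span_le]
      rintro _ ⟨i, hi, rfl⟩
      rw [SetLike.mem_coe, Submodule.mem_orthogonal_singleton_iff_inner_left]
      rw [← hΦ y ⟨i, hi⟩, hy]
      rfl
    have hyy := hle y.2
    rw [Submodule.mem_orthogonal_singleton_iff_inner_left, inner_self_eq_zero] at hyy
    exact Subtype.ext hyy
  obtain ⟨C, -, hC⟩ := Φ.exists_antilipschitzWith hker
  refine ⟨C, C.2, fun y hy δ hδ h => ?_⟩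
  have h1 := hC.le_mul_dist ⟨y, hy⟩ 0
  rw [map_zero, dist_zero_right, dist_zero_right] at h1
  refine h1.trans (mul_le_mul_of_nonneg_left ?_ C.2)
  rw [pi_norm_le_iff_of_nonneg hδ]
  intro i
  exact h i i.2

/-- Nearly isometric triangles have nearly equal inner products. -/
theorem abs_inner_sub_inner_le {a b a' b' : E} {R ε : ℝ} (hε : ε ≤ 1)
    (ha : ‖a‖ ≤ R) (hb : ‖b‖ ≤ R) (haa : |‖a'‖ - ‖a‖| ≤ ε) (hbb : |‖b'‖ - ‖b‖| ≤ ε)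
    (hab : |‖a' - b'‖ - ‖a - b‖| ≤ ε) :
    |inner ℝ a' b' - inner ℝ a b| ≤ (4 * R + 2) * ε := by
  have hε0 : 0 ≤ ε := (abs_nonneg _).trans haa
  have key : ∀ s t S : ℝ, 0 ≤ s → 0 ≤ t → t ≤ S → |s - t| ≤ ε →
      |s ^ 2 - t ^ 2| ≤ (2 * S + 1) * ε := by
    intro s t S hs ht htS hst
    have : s ^ 2 - t ^ 2 = (s + t) * (s - t) := by ring
    rw [this, abs_mul, abs_of_nonneg (add_nonneg hs ht)]
    have := (abs_le.mp hst).2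
    exact mul_le_mul (by linarith) hst (abs_nonneg _) (by linarith)
  have h1 := abs_le.mp (key _ _ R (norm_nonneg _) (norm_nonneg _) ha haa)
  have h2 := abs_le.mp (key _ _ R (norm_nonneg _) (norm_nonneg _) hb hbb)
  have h3 := abs_le.mp (key _ _ (2 * R) (norm_nonneg _) (norm_nonneg _)
    ((norm_sub_le a b).trans (by linarith)) hab)
  have e1 := norm_sub_sq_real a b
  have e2 := norm_sub_sq_real a' b'
  rw [abs_le]
  constructor <;> linarith [h1.1, h1.2, h2.1, h2.2, h3.1, h3.2]

/-- Two vectors of `Vᗮ` can be almost matched by a linear isometry fixing `V` pointwise, up to the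
difference of their norms. -/
theorem exists_linearIsometryEquiv_fixing (V : Submodule ℝ E) {h g : E}
    (hh : h ∈ Vᗮ) (hg : g ∈ Vᗮ) :
    ∃ S : E ≃ₗᵢ[ℝ] E, (∀ x ∈ V, S x = x) ∧ ‖g - S h‖ = |‖g‖ - ‖h‖| := by
  obtain ⟨g', hg', hnorm, hdist⟩ : ∃ g' ∈ Vᗮ, ‖h‖ = ‖g'‖ ∧ ‖g - g'‖ = |‖g‖ - ‖h‖| := by
    rcases eq_or_ne g 0 with rfl | hg0
    · exact ⟨h, hh, rfl, by simp⟩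
    · have hpos : 0 < ‖g‖ := norm_pos_iff.mpr hg0
      refine ⟨(‖h‖ / ‖g‖) • g, Vᗮ.smul_mem _ hg, ?_, ?_⟩
      · rw [norm_smul, norm_div, norm_norm, norm_norm, div_mul_cancel₀ _ hpos.ne']
      · have : g - (‖h‖ / ‖g‖) • g = ((‖g‖ - ‖h‖) / ‖g‖) • g := by
          rw [sub_div, div_self hpos.ne', sub_smul, one_smul]
        rw [this, norm_smul, norm_div, norm_norm, div_mul_cancel₀ _ hpos.ne', Real.norm_eq_abs]
  refine ⟨(ℝ ∙ (h - g'))ᗮ.reflection, fun x hx => ?_, ?_⟩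
  · rw [Submodule.reflection_eq_self_iff, Submodule.mem_orthogonal_singleton_iff_inner_left]
    exact (Submodule.mem_orthogonal V _).mp (Vᗮ.sub_mem hh hg') x hx
  · rw [Submodule.reflection_sub hnorm, hdist]

/-- If `b` is close to `a` and `⟪b, y⟫` is close to `⟪a, z⟫`, then `⟪a, y - z⟫` is small. -/
theorem abs_inner_sub_le {a b y z : E} {η δ B : ℝ} (hB : ‖y‖ ≤ B)
    (h : |inner ℝ b y - inner ℝ a z| ≤ η) (hab : ‖b - a‖ ≤ δ) :
    |inner ℝ a (y - z)| ≤ η + δ * B := by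
  have e : inner ℝ a (y - z) = (inner ℝ b y - inner ℝ a z) - inner ℝ (b - a) y := by
    rw [inner_sub_right, inner_sub_left]; ring
  rw [e]
  refine (abs_sub _ _).trans (add_le_add h ?_)
  exact (abs_real_inner_le_norm _ _).trans
    (mul_le_mul hab hB (norm_nonneg _) ((norm_nonneg _).trans hab))

/-- A family whose Gram matrix is close to that of a linearly independent family `v` is close to the
image of `v` under a linear isometry. -/
theorem exists_linearIsometryEquiv_of_gram_close (v : ℕ → E) (k : ℕ)
    (hv : ∀ j < k, v j ∉ Submodule.span ℝ (v '' Set.Iio j)) :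
    ∃ C ≥ (0 : ℝ), ∀ η : ℝ, 0 ≤ η → η ≤ 1 → ∀ w : ℕ → E,
      (∀ i < k, ∀ j < k, |inner ℝ (w i) (w j) - inner ℝ (v i) (v j)| ≤ η) →
      ∃ T : E ≃ₗᵢ[ℝ] E, ∀ i < k, ‖w i - T (v i)‖ ≤ C * η := by
  induction k with
  | zero => exact ⟨0, le_rfl, fun η _ _ w _ => ⟨LinearIsometryEquiv.refl ℝ E, by simp⟩⟩
  | succ k ih =>
    obtain ⟨C, hC, ih⟩ := ih fun j hj => hv j (by omega)
    obtain ⟨c, hc, hproj⟩ := exists_norm_le_mul_of_abs_inner_le v k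
    set V := Submodule.span ℝ (v '' Set.Iio k) with hV
    have hfin : FiniteDimensional ℝ V :=
      FiniteDimensional.span_of_finite ℝ ((Set.finite_Iio k).image v)
    set p : E := V.starProjection (v k) with hp
    have hpV : p ∈ V := V.starProjection_apply_mem _
    have hhV : v k - p ∈ Vᗮ := V.sub_starProjection_mem_orthogonal _
    have hh0 : 0 < ‖v k - p‖ := by
      rw [norm_pos_iff, sub_ne_zero]
      intro h
      exact hv k (by omega) (h ▸ hpV)
    set B : ℝ := ‖v k‖ + 1 with hBdef
    have hB : 0 ≤ B := by positivity
    set C₁ : ℝ := c * (1 + C * B) with hC₁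
    have hC₁0 : 0 ≤ C₁ := by positivity
    set C₂ : ℝ := (1 + C₁ * (2 * B)) / ‖v k - p‖ with hC₂
    have hC₂0 : 0 ≤ C₂ := by positivity
    refine ⟨C + C₁ + C₂, by positivity, fun η hη hη1 w hw => ?_⟩
    obtain ⟨T, hT⟩ := ih η hη hη1 w fun i hi j hj => hw i (by omega) j (by omega)
    set y : E := T.symm (w k) with hy
    set q : E := V.starProjection y with hq
    have hqV : q ∈ V := V.starProjection_apply_mem _
    have hgV : y - q ∈ Vᗮ := V.sub_starProjection_mem_orthogonal _
    have hynorm : ‖y‖ = ‖w k‖ := T.symm.norm_map _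
    have hsq : |‖y‖ ^ 2 - ‖v k‖ ^ 2| ≤ η := by
      have := hw k (by omega) k (by omega)
      rwa [real_inner_self_eq_norm_sq, real_inner_self_eq_norm_sq, ← hynorm] at this
    have hyB : ‖y‖ ≤ B := by
      refine abs_le_of_sq_le_sq' ?_ hB |>.2
      nlinarith [(abs_le.mp hsq).2, norm_nonneg (v k)]
    have hpB : ‖p‖ ≤ B := (V.norm_starProjection_apply_le _).trans (by linarith)
    have hqB : ‖q‖ ≤ B := (V.norm_starProjection_apply_le _).trans hyB
    have hqp : ‖q - p‖ ≤ C₁ * η := by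
      have h1 := hproj (q - p) (V.sub_mem hqV hpV) (η + C * η * B) (by positivity) ?_
      · exact h1.trans_eq (by rw [hC₁]; ring)
      · intro i hi
        have hvi : v i ∈ V := Submodule.subset_span ⟨i, hi, rfl⟩
        have e : inner ℝ (v i) (q - p) = inner ℝ (v i) (y - v k) := by
          have e1 := (Submodule.mem_orthogonal V _).mp hgV _ hvi
          have e2 := (Submodule.mem_orthogonal V _).mp hhV _ hvi
          rw [inner_sub_right] at e1 e2 ⊢
          rw [inner_sub_right]
          linarith
        rw [e]
        refine abs_inner_sub_le (b := T.symm (w i)) hyB ?_ ?_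
        · rw [hy, LinearIsometryEquiv.inner_map_map]
          exact hw i (by omega) k (by omega)
        · rw [← T.norm_map, map_sub, T.apply_symm_apply]
          exact hT i hi
    have hpyth : ∀ z : E, ‖z - V.starProjection z‖ ^ 2 = ‖z‖ ^ 2 - ‖V.starProjection z‖ ^ 2 := by
      intro z
      have h0 := (Submodule.mem_orthogonal V _).mp
        (V.sub_starProjection_mem_orthogonal z) _ (V.starProjection_apply_mem z)
      have h1 := norm_add_sq_real (V.starProjection z) (z - V.starProjection z)
      rw [h0, add_sub_cancel] at h1
      linarith
    have hnorms : |‖y - q‖ - ‖v k - p‖| ≤ C₂ * η := by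
      rw [hC₂, div_mul_eq_mul_div, le_div_iff₀ hh0]
      have h1 : |‖y - q‖ ^ 2 - ‖v k - p‖ ^ 2| ≤ (1 + C₁ * (2 * B)) * η := by
        rw [hpyth y, hpyth (v k)]
        have e : ‖y‖ ^ 2 - ‖q‖ ^ 2 - (‖v k‖ ^ 2 - ‖p‖ ^ 2)
            = (‖y‖ ^ 2 - ‖v k‖ ^ 2) - (‖q‖ - ‖p‖) * (‖q‖ + ‖p‖) := by ring
        rw [e]
        refine (abs_sub _ _).trans ?_
        have h2 : |(‖q‖ - ‖p‖) * (‖q‖ + ‖p‖)| ≤ C₁ * η * (2 * B) := by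
          rw [abs_mul, abs_of_nonneg (by positivity : 0 ≤ ‖q‖ + ‖p‖)]
          exact mul_le_mul ((abs_norm_sub_norm_le _ _).trans hqp) (by linarith)
            (by positivity) (by positivity)
        linarith
      refine le_trans ?_ h1
      have e : ‖y - q‖ ^ 2 - ‖v k - p‖ ^ 2
          = (‖y - q‖ - ‖v k - p‖) * (‖y - q‖ + ‖v k - p‖) := by ring
      rw [e, abs_mul, abs_of_nonneg (by positivity : 0 ≤ ‖y - q‖ + ‖v k - p‖)]
      exact mul_le_mul_of_nonneg_left (by linarith [norm_nonneg (y - q)]) (abs_nonneg _)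
    obtain ⟨S, hSV, hS⟩ := exists_linearIsometryEquiv_fixing V hhV hgV
    refine ⟨S.trans T, fun i hi => ?_⟩
    rw [LinearIsometryEquiv.trans_apply]
    rcases Nat.lt_succ_iff_lt_or_eq.mp hi with hi | rfl
    · rw [hSV (v i) (Submodule.subset_span ⟨i, hi, rfl⟩)]
      refine (hT i hi).trans (mul_le_mul_of_nonneg_right ?_ hη)
      linarith
    · have e : w i - T (S (v i)) = T ((q - p) + ((y - q) - S (v i - p))) := by
        rw [map_sub S, hSV p hpV]
        have : q - p + (y - q - (S (v i) - p)) = y - S (v i) := by abel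
        rw [this, map_sub, hy, T.apply_symm_apply]
      rw [e, T.norm_map]
      refine (norm_add_le _ _).trans ?_
      rw [hS]
      have : 0 ≤ C * η := by positivity
      linarith

/-- Vectors each outside the span of the previous ones span a space of full dimension. -/
theorem le_finrank_span_image_Iio [FiniteDimensional ℝ E] (v : ℕ → E) (k : ℕ)
    (hv : ∀ j < k, v j ∉ Submodule.span ℝ (v '' Set.Iio j)) :
    k ≤ Module.finrank ℝ (Submodule.span ℝ (v '' Set.Iio k)) := by
  induction k with
  | zero => exact Nat.zero_le _
  | succ k ih =>
    refine Nat.succ_le_of_lt ((ih fun j hj => hv j (by omega)).trans_lt ?_)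
    refine Submodule.finrank_lt_finrank_of_lt (lt_of_le_of_ne ?_ fun h => ?_)
    · exact Submodule.span_mono (Set.image_mono (Set.Iio_subset_Iio (Nat.le_succ k)))
    · exact hv k (Nat.lt_succ_self k)
        (h ▸ Submodule.subset_span ⟨k, Nat.lt_succ_self k, rfl⟩)

/-- Near-isometries of a bounded set are close to isometries, uniformly, if the set is either a
simplex or contains a simplex of full dimension. -/
theorem exists_isometry_approx_of_simplex [FiniteDimensional ℝ E] (D : Set E)
    (hD : Bornology.IsBounded D) (u : ℕ → E) (m : ℕ) (hu : ∀ k ≤ m, u k ∈ D)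
    (hv : ∀ j < m, u (j + 1) - u 0 ∉
      Submodule.span ℝ ((fun i => u (i + 1) - u 0) '' Set.Iio j))
    (hm : m = Module.finrank ℝ E ∨ ∀ x ∈ D, ∃ j ≤ m, x = u j) :
    ∃ Kstar > (0 : ℝ), ∀ ε : ℝ, 0 < ε → ∀ f : E → E,
      (∀ x ∈ D, ∀ y ∈ D, |‖f x - f y‖ - ‖x - y‖| ≤ ε) →
        ∃ U : E → E, (∀ x y, ‖U x - U y‖ = ‖x - y‖) ∧ ∀ x ∈ D, ‖f x - U x‖ ≤ Kstar * ε := by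
  obtain ⟨R, hR0, hR⟩ : ∃ R ≥ (0 : ℝ), ∀ x ∈ D, ‖x - u 0‖ ≤ R := by
    refine ⟨Metric.diam D, Metric.diam_nonneg, fun x hx => ?_⟩
    rw [← dist_eq_norm]
    exact Metric.dist_le_diam_of_mem hD hx (hu 0 (Nat.zero_le _))
  set v : ℕ → E := fun i => u (i + 1) - u 0 with hvdef
  obtain ⟨C, hC, hgram⟩ := exists_linearIsometryEquiv_of_gram_close v m hv
  obtain ⟨c, hc, hproj⟩ := exists_norm_le_mul_of_abs_inner_le v m
  set M : ℝ := 4 * R + 2 with hM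
  have hM0 : 0 < M := by positivity
  have hu0 := hu 0 (Nat.zero_le _)
  refine ⟨2 * R * M + 1 + C * M + c * (1 + C * (R + 1)) * M, by positivity,
    fun ε hε f hf => ?_⟩
  have hdist : ∀ x ∈ D, |‖f x - f (u 0)‖ - ‖x - u 0‖| ≤ ε := fun x hx => hf x hx _ hu0
  rcases lt_or_ge 1 (M * ε) with hlarge | hsmall
  · refine ⟨fun x => x - u 0 + f (u 0), fun x y => by
      rw [add_sub_add_right_eq_sub, sub_sub_sub_cancel_right], fun x hx => ?_⟩
    have e : f x - (x - u 0 + f (u 0)) = (f x - f (u 0)) - (x - u 0) := by abel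
    rw [e]
    refine (norm_sub_le _ _).trans ?_
    have h1 := (abs_le.mp (hdist x hx)).2
    have h2 := hR x hx
    have h3 : 2 * R * 1 ≤ 2 * R * (M * ε) := by gcongr
    have h4 : 0 ≤ (C * M + c * (1 + C * (R + 1)) * M) * ε := by positivity
    linarith
  · have hε1 : ε ≤ 1 := by nlinarith
    have hinner : ∀ x ∈ D, ∀ y ∈ D,
        |inner ℝ (f x - f (u 0)) (f y - f (u 0)) - inner ℝ (x - u 0) (y - u 0)| ≤ M * ε := by
      intro x hx y hy
      refine abs_inner_sub_inner_le hε1 (hR x hx) (hR y hy) (hdist x hx) (hdist y hy) ?_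
      rw [sub_sub_sub_cancel_right, sub_sub_sub_cancel_right]
      exact hf x hx y hy
    have hη : 0 ≤ M * ε := by positivity
    obtain ⟨T, hT⟩ := hgram (M * ε) hη hsmall (fun i => f (u (i + 1)) - f (u 0))
      fun i hi j hj => hinner _ (hu _ hi) _ (hu _ hj)
    refine ⟨fun x => T (x - u 0) + f (u 0), fun x y => ?_, fun x hx => ?_⟩
    · rw [add_sub_add_right_eq_sub, ← map_sub, T.norm_map, sub_sub_sub_cancel_right]
    have e : f x - (T (x - u 0) + f (u 0)) = (f x - f (u 0)) - T (x - u 0) := by abel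
    rw [e]
    have h0 : 0 ≤ (2 * R * M + 1) * ε := by positivity
    have h1 : 0 ≤ C * M * ε := by positivity
    have h2 : 0 ≤ c * (1 + C * (R + 1)) * M * ε := by positivity
    rcases hm with hm | hm
    · have htop : Submodule.span ℝ (v '' Set.Iio m) = ⊤ := by
        refine Submodule.eq_top_of_finrank_eq (le_antisymm (Submodule.finrank_le _) ?_)
        exact hm ▸ le_finrank_span_image_Iio v m hv
      set y : E := T.symm (f x - f (u 0)) with hy
      have hyR : ‖y‖ ≤ R + 1 := by
        rw [hy, T.symm.norm_map]
        linarith [(abs_le.mp (hdist x hx)).2, hR x hx]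
      have e2 : (f x - f (u 0)) - T (x - u 0) = T (y - (x - u 0)) := by
        rw [map_sub T y, hy, T.apply_symm_apply]
      rw [e2, T.norm_map]
      have h3 := hproj (y - (x - u 0)) (htop ▸ Submodule.mem_top)
        (M * ε + C * (M * ε) * (R + 1)) (by positivity) fun i hi => by
          refine abs_inner_sub_le (b := T.symm (f (u (i + 1)) - f (u 0))) hyR ?_ ?_
          · rw [hy, LinearIsometryEquiv.inner_map_map]
            exact hinner _ (hu _ hi) _ hx
          · rw [← T.norm_map, map_sub T, T.apply_symm_apply]
            exact hT i hi
      linarith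
    · obtain ⟨j, hj, rfl⟩ := hm x hx
      rcases j with - | i
      · simp only [sub_self, map_zero, norm_zero]
        positivity
      · have := hT i hj
        linarith

end EuclideanGeometry


/-- **Väisälä's theorem.** Let `D ⊆ ℝⁿ` be compact. Suppose there are points
`u₀, …, uₙ ∈ D` forming a maximal sequence (with `h_k = dist(u_k, A_{k-1})`,
`A_{k-1}` the affine span of `u₀, …, u_{k-1}`) and a constant `K ≥ 1` with
(i) `‖u_k - u₀‖ ≤ K h_k` for `2 ≤ k ≤ n`, and
(ii) `D \ {u₁, …, uₙ} ⊆ B̄(u₀, K hₙ)`. Then there is `K* > 0` such that every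
`ε`-isometry `f : D → ℝⁿ` is within `K* ε` of an isometry `U : ℝⁿ → ℝⁿ`. -/
theorem vaisala (n : ℕ) (hn : 1 ≤ n)
    (D : Set (EuclideanSpace ℝ (Fin n))) (hD : IsCompact D)
    (u : ℕ → EuclideanSpace ℝ (Fin n)) (hu : ∀ k ≤ n, u k ∈ D)
    (K : ℝ) (hK : 1 ≤ K)
    (hmax : ∀ k, 1 ≤ k → k ≤ n → ∀ x ∈ D,
      Metric.infDist x
        ((affineSpan ℝ (u '' {j | j < k}) : AffineSubspace ℝ (EuclideanSpace ℝ (Fin n))) :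
          Set (EuclideanSpace ℝ (Fin n))) ≤
      Metric.infDist (u k)
        ((affineSpan ℝ (u '' {j | j < k}) : AffineSubspace ℝ (EuclideanSpace ℝ (Fin n))) :
          Set (EuclideanSpace ℝ (Fin n))))
    (hi : ∀ k, 2 ≤ k → k ≤ n →
      ‖u k - u 0‖ ≤ K * Metric.infDist (u k)
        ((affineSpan ℝ (u '' {j | j < k}) : AffineSubspace ℝ (EuclideanSpace ℝ (Fin n))) :
          Set (EuclideanSpace ℝ (Fin n))))
    (hii : D \ (u '' {j | 1 ≤ j ∧ j ≤ n}) ⊆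
      Metric.closedBall (u 0)
        (K * Metric.infDist (u n)
          ((affineSpan ℝ (u '' {j | j < n}) : AffineSubspace ℝ (EuclideanSpace ℝ (Fin n))) :
            Set (EuclideanSpace ℝ (Fin n))))) :
    ∃ Kstar > (0 : ℝ), ∀ ε : ℝ, 0 < ε →
      ∀ f : EuclideanSpace ℝ (Fin n) → EuclideanSpace ℝ (Fin n),
        (∀ x ∈ D, ∀ y ∈ D, |‖f x - f y‖ - ‖x - y‖| ≤ ε) →
        ∃ U : EuclideanSpace ℝ (Fin n) → EuclideanSpace ℝ (Fin n),
          (∀ x y, ‖U x - U y‖ = ‖x - y‖) ∧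
          ∀ x ∈ D, ‖f x - U x‖ ≤ Kstar * ε := by
  set A : ℕ → AffineSubspace ℝ (EuclideanSpace ℝ (Fin n)) :=
    fun k => affineSpan ℝ (u '' {j | j < k}) with hA
  have hmem0 : ∀ k, 1 ≤ k → u 0 ∈ A k := fun k hk => subset_affineSpan ℝ _ ⟨0, hk, rfl⟩
  have hindep : ∀ m, (∀ k, 1 ≤ k → k ≤ m → Metric.infDist (u k) (A k : Set _) ≠ 0) →
      ∀ j < m, u (j + 1) - u 0 ∉
        Submodule.span ℝ ((fun i => u (i + 1) - u 0) '' Set.Iio j) := by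
    intro m hne j hj hmem
    refine hne (j + 1) (by omega) hj (Metric.infDist_zero_of_mem ?_)
    have hle : Submodule.span ℝ ((fun i => u (i + 1) - u 0) '' Set.Iio j) ≤
        (A (j + 1)).direction := by
      rw [Submodule.span_le]
      rintro _ ⟨i, hi, rfl⟩
      exact AffineSubspace.vsub_mem_direction
        (subset_affineSpan ℝ _ ⟨i + 1, Nat.succ_lt_succ hi, rfl⟩) (hmem0 _ (by omega))
    have := AffineSubspace.vadd_mem_of_mem_direction (hle hmem) (hmem0 (j + 1) (by omega))
    simpa using this
  by_cases hpos : ∀ k, 1 ≤ k → k ≤ n → Metric.infDist (u k) (A k : Set _) ≠ 0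
  · exact exists_isometry_approx_of_simplex D hD.isBounded u n hu (hindep n hpos)
      (Or.inl finrank_euclideanSpace_fin.symm)
  push Not at hpos
  classical
  set k := Nat.find hpos with hk
  obtain ⟨hk1, hkn, hk0⟩ := Nat.find_spec hpos
  rw [← hk] at hk1 hkn hk0
  have hzero : ∀ j, k ≤ j → j ≤ n → Metric.infDist (u j) (A j : Set _) = 0 := by
    intro j hkj hjn
    refine le_antisymm ?_ Metric.infDist_nonneg
    calc Metric.infDist (u j) (A j : Set _) ≤ Metric.infDist (u j) (A k : Set _) :=
          Metric.infDist_le_infDist_of_subset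
            (affineSpan_mono ℝ (Set.image_mono fun i (hi : i < k) => hi.trans_le hkj))
            ⟨u 0, hmem0 k hk1⟩
      _ ≤ Metric.infDist (u k) (A k : Set _) := hmax k hk1 hkn _ (hu j hjn)
      _ = 0 := hk0
  have hcollapse : ∀ j, k ≤ j → j ≤ n → u j = u 0 := by
    intro j hkj hjn
    have hj0 := hzero j hkj hjn
    rcases Nat.lt_or_ge 1 j with hj | hj
    · have h := hi j hj hjn
      rw [show Metric.infDist (u j) _ = 0 from hj0, mul_zero] at h
      exact sub_eq_zero.mp (norm_le_zero_iff.mp h)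
    · obtain rfl : j = 1 := by omega
      have hs : u '' {j | j < 1} = {u 0} := by
        ext x; simp
      simpa [hA, hs, sub_eq_zero] using hj0
  refine exists_isometry_approx_of_simplex D hD.isBounded u (k - 1)
    (fun j hj => hu j (by omega)) (hindep _ fun j hj1 hj h => ?_) (Or.inr fun x hx => ?_)
  · exact Nat.find_min hpos (show j < k by omega) ⟨hj1, by omega, h⟩
  · by_cases hxu : x ∈ u '' {j | 1 ≤ j ∧ j ≤ n}
    · obtain ⟨j, ⟨hj1, hjn⟩, rfl⟩ := hxu
      rcases Nat.lt_or_ge j k with hjk | hjk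
      · exact ⟨j, by omega, rfl⟩
      · exact ⟨0, Nat.zero_le _, hcollapse j hjk hjn⟩
    · have h := hii ⟨hx, hxu⟩
      rw [show Metric.infDist (u n) _ = 0 from hzero n hkn le_rfl, mul_zero,
        Metric.closedBall_zero] at h
      exact ⟨0, Nat.zero_le _, h⟩
end
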